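/- Let m ∈ ℝ, let Φ, Ψ be Schwartz functions on ℝⁿ, and let {a_{j,k,l}} (integer j ≥ 0, k, l ∈ ℤⁿ) be complex numbers such that for every N > 0 there is a constant C_N with |a_{j,k,l}| ≤ C_N 2^{−jN} (1+2^{−j}|l|)^m for all j, k, l. Then the series σ(x,ξ) = ∑_{j,k,l} a_{j,k,l} 2^{jn} Φ(2^j x − k) Ψ(2^j ξ − l) converges absolutely, together with all its termwise derivatives, to a smooth function σ on ℝⁿ × ℝⁿ, and σ ∈ S^m_{0,0}: for all multi-indices α, β ∈ ℕⁿ there is C_{α,β} such that |∂_x^α ∂_ξ^β σ(x,ξ)| ≤ C_{α,β} (1+|ξ|)^m. -/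

import Mathlib

open MeasureTheory Complex
open scoped RealInnerProductSpace ENNReal NNReal

noncomputable section

abbrev En (n : ℕ) : Type := EuclideanSpace ℝ (Fin n)

/-- Image of an integer vector `k ∈ ℤⁿ` in `ℝⁿ`. -/
def intVec (n : ℕ) (k : Fin n → ℤ) : En n :=
  (EuclideanSpace.equiv (Fin n) ℝ).symm fun i => (k i : ℝ)

/-- The unit coordinate vector `eᵢ` of `ℝⁿ`. -/
def unitE (n : ℕ) (i : Fin n) : En n := EuclideanSpace.single i 1

/-- Iterated directional (partial) derivative along the list of directions `L`. -/
def pdSeq {V : Type*} [NormedAddCommGroup V] [NormedSpace ℝ V] (L : List V) (f : V → ℂ) :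
    V → ℂ :=
  L.foldr (fun v g => fun x => fderiv ℝ g x v) f

/-- The list of directions encoding the multi-index `α`: direction `dir i` repeated `α i`
times. -/
def dirList {V : Type*} {n : ℕ} (α : Fin n → ℕ) (dir : Fin n → V) : List V :=
  (List.ofFn fun i => List.replicate (α i) (dir i)).flatten

/-- The mixed partial derivative `∂_x^α ∂_ξ^β σ` of a symbol `σ(x,ξ)` on `ℝⁿ × ℝⁿ`. -/
def mixD (n : ℕ) (α β : Fin n → ℕ) (σ : En n × En n → ℂ) : En n × En n → ℂ :=
  pdSeq (dirList α (fun i => (unitE n i, (0 : En n))) ++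
    dirList β (fun i => ((0 : En n), unitE n i))) σ

/-- The Hörmander class `S^m_{ρ,δ}`: `σ` is smooth and
`|∂_x^α ∂_ξ^β σ(x,ξ)| ≤ C_{α,β} (1+|ξ|)^{m − ρ|β| + δ|α|}`. -/
def IsHormander (n : ℕ) (m ρ δ : ℝ) (σ : En n × En n → ℂ) : Prop :=
  ContDiff ℝ (⊤ : ℕ∞) σ ∧
  ∀ α β : Fin n → ℕ, ∃ C : ℝ, ∀ x ξ : En n,
    ‖mixD n α β σ (x, ξ)‖ ≤
      C * (1 + ‖ξ‖) ^ (m - ρ * (∑ i, (β i : ℝ)) + δ * (∑ i, (α i : ℝ)))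

/-- The difference operator `Δ_h g(X) = g(X+h) − g(X)`. -/
def idiff {V : Type*} [Add V] (h : V) (g : V → ℂ) : V → ℂ := fun X => g (X + h) - g X

/-- The Besov `B^{α,∞}_∞` norm (valued in `ℝ≥0∞`):
`‖g‖_∞ + sup_{h≠0} |h|^{−α} ‖Δ_h^{α+1} g‖_∞`. -/
def besovE (n : ℕ) (α : ℕ) (g : En n → ℂ) : ℝ≥0∞ :=
  (⨆ x, (‖g x‖₊ : ℝ≥0∞)) +
    ⨆ (h : En n) (_ : h ≠ 0),
      ((‖h‖₊ : ℝ≥0∞) ^ (α : ℝ))⁻¹ * ⨆ x, (‖(idiff h)^[α + 1] g x‖₊ : ℝ≥0∞)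

/-- The partial derivative `∂_ξ^β σ` in the `ξ`-variables only. -/
def xiD (n : ℕ) (β : Fin n → ℕ) (σ : En n × En n → ℂ) : En n → En n → ℂ :=
  fun x => pdSeq (dirList β (unitE n)) (fun ξ => σ (x, ξ))

/-- The class `S̃^m_{ρ,δ}`: `σ(x,ξ)` is smooth in `ξ`, its `ξ`-derivatives are continuous,
and `‖∂_ξ^β σ(·,ξ)‖_{B^{α,∞}_∞} ≤ C_{α,β} (1+|ξ|)^{m − ρ|β| + δα}` (the Besov norm taken in
the `x`-variable). -/
def IsTilde (n : ℕ) (m ρ δ : ℝ) (σ : En n × En n → ℂ) : Prop :=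
  (∀ x : En n, ContDiff ℝ (⊤ : ℕ∞) fun ξ => σ (x, ξ)) ∧
  (∀ β : Fin n → ℕ, Continuous fun X : En n × En n => xiD n β σ X.1 X.2) ∧
  ∀ (β : Fin n → ℕ) (α : ℕ), ∃ C : ℝ, ∀ ξ : En n,
    besovE n α (fun x => xiD n β σ x ξ) ≤
      ENNReal.ofReal (C * (1 + ‖ξ‖) ^ (m - ρ * (∑ i, (β i : ℝ)) + δ * α))

/-- The term `a_{j,k,l} 2^{jn} Φ(2^j x − k) Ψ(2^j ξ − l)` of the wavelet series. -/
def wterm (n : ℕ) (Φ Ψ : SchwartzMap (En n) ℂ) (a : ℕ × (Fin n → ℤ) × (Fin n → ℤ) → ℂ)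
    (q : ℕ × (Fin n → ℤ) × (Fin n → ℤ)) : En n × En n → ℂ :=
  fun X => a q * (2 : ℂ) ^ (q.1 * n) * Φ ((2 : ℝ) ^ q.1 • X.1 - intVec n q.2.1) *
    Ψ ((2 : ℝ) ^ q.1 • X.2 - intVec n q.2.2)

/-- A family of smooth functions all of whose derivatives are summable locally uniformly. -/
def GoodFam {ι V : Type*} [NormedAddCommGroup V] [NormedSpace ℝ V] (F : ι → V → ℂ) : Prop :=
  (∀ q, ContDiff ℝ (⊤ : ℕ∞) (F q)) ∧ ∀ (k : ℕ) (R : ℝ), ∃ u : ι → ℝ, Summable u ∧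
    ∀ q X, ‖X‖ < R → ‖iteratedFDeriv ℝ k (F q) X‖ ≤ u q

section good
variable {ι V : Type*} [NormedAddCommGroup V] [NormedSpace ℝ V]

lemma smooth_dir {f : V → ℂ} (hf : ContDiff ℝ (⊤ : ℕ∞) f) (v : V) :
    ContDiff ℝ (⊤ : ℕ∞) (fun x => fderiv ℝ f x v) :=
  ((contDiff_infty_iff_fderiv.1 hf).2).clm_apply contDiff_const

lemma bound_dir {f : V → ℂ} (hf : ContDiff ℝ (⊤ : ℕ∞) f) (v : V) (k : ℕ) (X : V) :
    ‖iteratedFDeriv ℝ k (fun x => fderiv ℝ f x v) X‖ ≤ ‖v‖ * ‖iteratedFDeriv ℝ (k + 1) f X‖ := by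
  rw [← norm_iteratedFDeriv_fderiv]
  exact norm_iteratedFDeriv_clm_apply_const
    (((contDiff_infty_iff_fderiv.1 hf).2).contDiffAt) (by exact_mod_cast le_top)

lemma pdSeq_cons (v : V) (L : List V) (f : V → ℂ) :
    pdSeq (v :: L) f = fun x => fderiv ℝ (pdSeq L f) x v := rfl

lemma smooth_pdSeq {f : V → ℂ} (hf : ContDiff ℝ (⊤ : ℕ∞) f) (L : List V) :
    ContDiff ℝ (⊤ : ℕ∞) (pdSeq L f) := by
  induction L with
  | nil => exact hf
  | cons v L ih => rw [pdSeq_cons]; exact smooth_dir ih v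

lemma bound_pdSeq (L : List V) : ∃ D : ℝ, 0 ≤ D ∧ ∀ f : V → ℂ, ContDiff ℝ (⊤ : ℕ∞) f →
    ∀ (k : ℕ) (X : V), ‖iteratedFDeriv ℝ k (pdSeq L f) X‖ ≤
      D * ‖iteratedFDeriv ℝ (k + L.length) f X‖ := by
  induction L with
  | nil => exact ⟨1, zero_le_one, fun f hf k X => by simp [pdSeq]⟩
  | cons v L ih =>
    obtain ⟨D, hD, h⟩ := ih
    refine ⟨‖v‖ * D, by positivity, fun f hf k X => ?_⟩
    rw [pdSeq_cons]
    refine (bound_dir (smooth_pdSeq hf L) v k X).trans ?_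
    rw [mul_assoc]
    refine mul_le_mul_of_nonneg_left ?_ (norm_nonneg v)
    have := h f hf (k + 1) X
    rwa [List.length_cons, show k + (L.length + 1) = k + 1 + L.length by ring]

lemma GoodFam.summable {F : ι → V → ℂ} (h : GoodFam F) (X : V) :
    Summable fun q => ‖F q X‖ := by
  obtain ⟨u, hu, hb⟩ := h.2 0 (‖X‖ + 1)
  refine Summable.of_nonneg_of_le (fun _ => norm_nonneg _) (fun q => ?_) hu
  have := hb q X (by linarith)
  rwa [norm_iteratedFDeriv_zero] at this

lemma GoodFam.dir {F : ι → V → ℂ} (h : GoodFam F) (v : V) :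
    GoodFam fun q x => fderiv ℝ (F q) x v := by
  refine ⟨fun q => smooth_dir (h.1 q) v, fun k R => ?_⟩
  obtain ⟨u, hu, hb⟩ := h.2 (k + 1) R
  exact ⟨fun q => ‖v‖ * u q, hu.mul_left _, fun q X hX => (bound_dir (h.1 q) v k X).trans
    (mul_le_mul_of_nonneg_left (hb q X hX) (norm_nonneg v))⟩

lemma GoodFam.fderiv_bound {F : ι → V → ℂ} (h : GoodFam F) (R : ℝ) :
    ∃ u : ι → ℝ, Summable u ∧ ∀ q X, ‖X‖ < R → ‖fderiv ℝ (F q) X‖ ≤ u q := by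
  obtain ⟨u, hu, hb⟩ := h.2 1 R
  refine ⟨u, hu, fun q X hX => ?_⟩
  have := hb q X hX
  rw [show (1 : ℕ) = 0 + 1 from rfl, ← norm_iteratedFDeriv_fderiv] at this
  rwa [norm_iteratedFDeriv_zero] at this

lemma GoodFam.hasFDerivAt {F : ι → V → ℂ} (h : GoodFam F) (X : V) :
    HasFDerivAt (fun x => ∑' q, F q x) (∑' q, fderiv ℝ (F q) X) X := by
  obtain ⟨u, hu, hb⟩ := h.fderiv_bound (‖X‖ + 1)
  have hX : X ∈ Metric.ball (0 : V) (‖X‖ + 1) := by simp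
  refine hasFDerivAt_tsum_of_isPreconnected hu Metric.isOpen_ball
    (convex_ball (0 : V) _).isPreconnected (fun q x _ => ?_) (fun q x hx => ?_) hX
    (h.summable X).of_norm hX
  · exact ((contDiff_infty_iff_fderiv.1 (h.1 q)).1 x).hasFDerivAt
  · exact hb q x (by simpa using hx)

lemma GoodFam.fderiv_tsum {F : ι → V → ℂ} (h : GoodFam F) (v : V) :
    (fun x => fderiv ℝ (fun x => ∑' q, F q x) x v) = fun x => ∑' q, fderiv ℝ (F q) x v := by
  ext X
  rw [(h.hasFDerivAt X).fderiv]
  obtain ⟨u, hu, hb⟩ := h.fderiv_bound (‖X‖ + 1)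
  have hs : Summable fun q => fderiv ℝ (F q) X :=
    Summable.of_norm_bounded hu fun q => hb q X (by linarith)
  exact (ContinuousLinearMap.apply ℝ ℂ v).map_tsum hs

lemma GoodFam.contDiff_nat [FiniteDimensional ℝ V] (k : ℕ) : ∀ {F : ι → V → ℂ}, GoodFam F →
    ContDiff ℝ k (fun x => ∑' q, F q x) := by
  induction k with
  | zero =>
    intro F h
    refine contDiff_zero.2 (continuous_iff_continuousAt.2 fun X => (h.hasFDerivAt X).continuousAt)
  | succ k ih =>
    intro F h
    push_cast
    refine contDiff_succ_iff_fderiv_apply.2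
      ⟨fun X => (h.hasFDerivAt X).differentiableAt, fun h => by simp at h, fun v => ?_⟩
    rw [h.fderiv_tsum v]
    exact ih (h.dir v)

lemma GoodFam.contDiff [FiniteDimensional ℝ V] {F : ι → V → ℂ} (h : GoodFam F) :
    ContDiff ℝ (⊤ : ℕ∞) (fun x => ∑' q, F q x) :=
  contDiff_infty.2 fun k => h.contDiff_nat k

lemma GoodFam.pdSeq {F : ι → V → ℂ} (h : GoodFam F) (L : List V) :
    GoodFam (fun q => pdSeq L (F q)) ∧
      _root_.pdSeq L (fun x => ∑' q, F q x) = fun x => ∑' q, _root_.pdSeq L (F q) x := by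
  induction L with
  | nil => exact ⟨h, rfl⟩
  | cons v L ih =>
    refine ⟨ih.1.dir v, ?_⟩
    rw [pdSeq_cons, ih.2, ih.1.fderiv_tsum v]
    rfl

end good

lemma summable_prodZ (n : ℕ) :
    Summable fun k : Fin n → ℤ => ∏ i, ((1 + |(k i : ℝ)|) ^ 2)⁻¹ := by
  induction n with
  | zero => exact .of_finite
  | succ n ih =>
    have h1 : Summable fun k : ℤ => ((1 + |(k : ℝ)|) ^ 2)⁻¹ := by
      have h0 : Summable fun k : ℕ => ((1 + |((k : ℤ) : ℝ)|) ^ 2)⁻¹ := by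
        have := (summable_nat_add_iff 1).2 (Real.summable_nat_pow_inv.2 (one_lt_two))
        refine this.congr fun k => ?_
        rw [abs_of_nonneg (by positivity)]
        push_cast
        rw [add_comm]
      refine Summable.of_nat_of_neg h0 ?_
      simpa using h0
    have h2 := h1.mul_of_nonneg ih (fun _ => by positivity)
      (fun _ => Finset.prod_nonneg fun _ _ => by positivity)
    rw [← (Fin.consEquiv (fun _ : Fin (n + 1) => ℤ)).summable_iff]
    refine h2.congr fun p => ?_
    simp [Fin.prod_univ_succ, Fin.consEquiv, mul_comm]

lemma intVec_apply (n : ℕ) (k : Fin n → ℤ) (i : Fin n) : intVec n k i = (k i : ℝ) := rfl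

lemma summable_wZ (n : ℕ) :
    Summable fun k : Fin n → ℤ => ((1 + ‖intVec n k‖) ^ (2 * n))⁻¹ := by
  refine Summable.of_nonneg_of_le (fun _ => by positivity) (fun k => ?_) (summable_prodZ n)
  rw [Finset.prod_inv_distrib]
  refine inv_anti₀ (Finset.prod_pos fun _ _ => by positivity) ?_
  rw [pow_mul]
  calc ∏ i, (1 + |(k i : ℝ)|) ^ 2 ≤ ∏ i : Fin n, (1 + ‖intVec n k‖) ^ 2 := by
        refine Finset.prod_le_prod (fun _ _ => by positivity) fun i _ => ?_
        have := PiLp.norm_apply_le (intVec n k) i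
        rw [intVec_apply, Real.norm_eq_abs] at this
        gcongr
    _ = _ := by simp

/-- The summable weight. -/
def gw (n : ℕ) (q : ℕ × (Fin n → ℤ) × (Fin n → ℤ)) : ℝ :=
  ((2 : ℝ) ^ q.1)⁻¹ * (((1 + ‖intVec n q.2.1‖) ^ (2 * n))⁻¹ * ((1 + ‖intVec n q.2.2‖) ^ (2 * n))⁻¹)

lemma gw_nonneg (n : ℕ) (q) : 0 ≤ gw n q := by unfold gw; positivity

lemma summable_gw (n : ℕ) : Summable (gw n) := by
  have h0 : Summable fun j : ℕ => ((2 : ℝ) ^ j)⁻¹ := by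
    simpa using summable_geometric_two
  have h1 := (summable_wZ n).mul_of_nonneg (summable_wZ n) (fun _ => by positivity)
    (fun _ => by positivity)
  exact h0.mul_of_nonneg h1 (fun _ => by positivity) (fun _ => by positivity)

lemma peetre {A B D m : ℝ} {s : ℕ} (hA : 1 ≤ A) (hB : 1 ≤ B) (hD : 1 ≤ D) (h1 : A ≤ B * D)
    (h2 : B ≤ A * D) (hs : |m| ≤ s) : A ^ m ≤ B ^ m * D ^ s := by
  have hA0 : 0 < A := by linarith
  have hB0 : 0 < B := by linarith
  have hD0 : 0 < D := by linarith
  have hDs : D ^ |m| ≤ D ^ s := by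
    rw [← Real.rpow_natCast]
    exact Real.rpow_le_rpow_of_exponent_le hD hs
  refine le_trans ?_ (mul_le_mul_of_nonneg_left hDs (by positivity))
  rcases le_total 0 m with hm | hm
  · rw [abs_of_nonneg hm, ← Real.mul_rpow hB0.le hD0.le]
    exact Real.rpow_le_rpow hA0.le h1 hm
  · rw [abs_of_nonpos hm]
    have h3 := Real.rpow_le_rpow hB0.le h2 (neg_nonneg.2 hm)
    rw [Real.mul_rpow hA0.le hD0.le] at h3
    have e1 : A ^ m * A ^ (-m) = 1 := by rw [← Real.rpow_add hA0]; simp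
    have e2 : B ^ m * B ^ (-m) = 1 := by rw [← Real.rpow_add hB0]; simp
    calc A ^ m = A ^ m * B ^ m * B ^ (-m) := by rw [mul_assoc, e2, mul_one]
      _ ≤ A ^ m * B ^ m * (A ^ (-m) * D ^ (-m)) := by gcongr
      _ = (A ^ m * A ^ (-m)) * (B ^ m * D ^ (-m)) := by ring
      _ = _ := by rw [e1, one_mul]

lemma schwartz_decay {n : ℕ} (Φ : SchwartzMap (En n) ℂ) (K M : ℕ) : ∃ C : ℝ, 0 ≤ C ∧
    ∀ i ≤ K, ∀ y, ‖iteratedFDeriv ℝ i Φ y‖ ≤ C * ((1 + ‖y‖) ^ M)⁻¹ := by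
  refine ⟨2 ^ M * (Finset.Iic (M, K)).sup (fun m => SchwartzMap.seminorm ℝ m.1 m.2) Φ,
    by positivity, fun i hi y => ?_⟩
  have := SchwartzMap.one_add_le_sup_seminorm_apply (𝕜 := ℝ) (m := (M, K)) le_rfl hi Φ y
  rw [le_mul_inv_iff₀ (by positivity), mul_comm]
  exact this

/-- Derivative bound for an affine rescaling of a Schwartz function. -/
lemma comp_bound {n : ℕ} (Φ : SchwartzMap (En n) ℂ) (p : En n × En n →L[ℝ] En n) (hp : ‖p‖ ≤ 1)
    (j : ℕ) (c : En n) (i : ℕ) (X : En n × En n) :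
    ‖iteratedFDeriv ℝ i (fun X => Φ ((2 : ℝ) ^ j • p X - c)) X‖ ≤
      ‖iteratedFDeriv ℝ i Φ ((2 : ℝ) ^ j • p X - c)‖ * ((2 : ℝ) ^ j) ^ i := by
  have hf : ContDiff ℝ (⊤ : ℕ∞) (fun y => Φ (y - c)) :=
    (Φ.smooth _).comp (contDiff_id.sub contDiff_const)
  have := ((2 : ℝ) ^ j • p).iteratedFDeriv_comp_right hf X (i := i) (by exact_mod_cast le_top)
  have e : (fun X => Φ ((2 : ℝ) ^ j • p X - c)) = (fun y => Φ (y - c)) ∘ ((2 : ℝ) ^ j • p) := rfl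
  rw [e, this]
  refine (ContinuousMultilinearMap.norm_compContinuousLinearMap_le _ _).trans ?_
  rw [iteratedFDeriv_comp_sub]
  simp only [Finset.prod_const, Finset.card_univ, Fintype.card_fin]
  refine mul_le_mul_of_nonneg_left (pow_le_pow_left₀ (norm_nonneg _) ?_ i) (norm_nonneg _)
  rw [norm_smul]
  simpa using hp

lemma smooth_comp {n : ℕ} (Φ : SchwartzMap (En n) ℂ) (p : En n × En n →L[ℝ] En n)
    (j : ℕ) (c : En n) : ContDiff ℝ (⊤ : ℕ∞) (fun X => Φ ((2 : ℝ) ^ j • p X - c)) :=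
  (Φ.smooth _).comp ((p.contDiff.const_smul _).sub contDiff_const)

lemma smooth_wterm (n : ℕ) (Φ Ψ : SchwartzMap (En n) ℂ) (a) (q) :
    ContDiff ℝ (⊤ : ℕ∞) (wterm n Φ Ψ a q) :=
  (contDiff_const.mul (smooth_comp Φ (ContinuousLinearMap.fst ℝ _ _) q.1 _)).mul
    (smooth_comp Ψ (ContinuousLinearMap.snd ℝ _ _) q.1 _)

lemma wterm_bound (n : ℕ) (Φ Ψ : SchwartzMap (En n) ℂ) (a) (K M : ℕ) : ∃ C : ℝ, 0 ≤ C ∧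
    ∀ (q : ℕ × (Fin n → ℤ) × (Fin n → ℤ)) (X : En n × En n),
    ‖iteratedFDeriv ℝ K (wterm n Φ Ψ a q) X‖ ≤ C * (‖a q‖ * (2 : ℝ) ^ (q.1 * (n + K))) *
      ((1 + ‖(2 : ℝ) ^ q.1 • X.1 - intVec n q.2.1‖) ^ M)⁻¹ *
      ((1 + ‖(2 : ℝ) ^ q.1 • X.2 - intVec n q.2.2‖) ^ M)⁻¹ := by
  obtain ⟨C1, hC1, h1⟩ := schwartz_decay Φ K M
  obtain ⟨C2, hC2, h2⟩ := schwartz_decay Ψ K M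
  refine ⟨2 ^ K * C1 * C2, by positivity, fun q X => ?_⟩
  set f := fun X : En n × En n =>
    Φ ((2 : ℝ) ^ q.1 • ContinuousLinearMap.fst ℝ (En n) (En n) X - intVec n q.2.1) with hf
  set g := fun X : En n × En n =>
    Ψ ((2 : ℝ) ^ q.1 • ContinuousLinearMap.snd ℝ (En n) (En n) X - intVec n q.2.2) with hg
  have sf : ContDiff ℝ (⊤ : ℕ∞) f := smooth_comp Φ _ _ _
  have sg : ContDiff ℝ (⊤ : ℕ∞) g := smooth_comp Ψ _ _ _
  have e : wterm n Φ Ψ a q = (a q * (2 : ℂ) ^ (q.1 * n)) • fun X => f X * g X := by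
    ext X
    simp [wterm, hf, hg, mul_assoc]
  rw [e, iteratedFDeriv_const_smul_apply ((sf.mul sg).contDiffAt.of_le (by exact_mod_cast le_top)),
    norm_smul]
  set u := ((1 + ‖(2 : ℝ) ^ q.1 • X.1 - intVec n q.2.1‖) ^ M)⁻¹ with hu
  set v := ((1 + ‖(2 : ℝ) ^ q.1 • X.2 - intVec n q.2.2‖) ^ M)⁻¹ with hv
  have u0 : 0 ≤ u := by positivity
  have v0 : 0 ≤ v := by positivity
  have hprod : ‖iteratedFDeriv ℝ K (fun X => f X * g X) X‖ ≤
      2 ^ K * (C1 * C2 * u * v * (2 : ℝ) ^ (q.1 * K)) := by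
    refine (norm_iteratedFDeriv_mul_le sf sg X (by exact_mod_cast le_top)).trans ?_
    have hsum : (2 : ℝ) ^ K = ∑ i ∈ Finset.range (K + 1), (K.choose i : ℝ) := by
      exact_mod_cast (Nat.sum_range_choose K).symm
    rw [hsum, Finset.sum_mul]
    refine Finset.sum_le_sum fun i hi => ?_
    have hi' : i ≤ K := Nat.lt_succ_iff.1 (Finset.mem_range.1 hi)
    have b1 : ‖iteratedFDeriv ℝ i f X‖ ≤ C1 * u * ((2 : ℝ) ^ q.1) ^ i :=
      (comp_bound Φ _ (ContinuousLinearMap.norm_fst_le _ _ _) q.1 _ i X).trans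
        (mul_le_mul_of_nonneg_right (h1 i hi' _) (by positivity))
    have b2 : ‖iteratedFDeriv ℝ (K - i) g X‖ ≤ C2 * v * ((2 : ℝ) ^ q.1) ^ (K - i) :=
      (comp_bound Ψ _ (ContinuousLinearMap.norm_snd_le _ _ _) q.1 _ (K - i) X).trans
        (mul_le_mul_of_nonneg_right (h2 (K - i) (Nat.sub_le _ _) _) (by positivity))
    have ep : ((2 : ℝ) ^ q.1) ^ i * ((2 : ℝ) ^ q.1) ^ (K - i) = (2 : ℝ) ^ (q.1 * K) := by
      rw [← pow_add, Nat.add_sub_cancel' hi', pow_mul]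
    rw [← ep, mul_assoc]
    refine mul_le_mul_of_nonneg_left ?_ (by positivity)
    calc _ ≤ (C1 * u * ((2 : ℝ) ^ q.1) ^ i) * (C2 * v * ((2 : ℝ) ^ q.1) ^ (K - i)) := by gcongr
      _ = _ := by ring
  have en : ‖a q * (2 : ℂ) ^ (q.1 * n)‖ = ‖a q‖ * (2 : ℝ) ^ (q.1 * n) := by simp
  rw [en]
  calc _ ≤ ‖a q‖ * (2 : ℝ) ^ (q.1 * n) * (2 ^ K * (C1 * C2 * u * v * (2 : ℝ) ^ (q.1 * K))) := by
        gcongr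
    _ = _ := by rw [mul_add, pow_add]; ring

lemma inv_pow_aux {x y z : ℝ} (hx : 1 ≤ x) (hy : 1 ≤ y) (hz : 1 ≤ z) (h : x ≤ y * z) (M : ℕ) :
    (y ^ M)⁻¹ ≤ z ^ M * (x ^ M)⁻¹ := by
  have hx0 : 0 < x := by linarith
  have hy0 : 0 < y := by linarith
  have hz0 : 0 < z := by linarith
  rw [le_mul_inv_iff₀ (by positivity), inv_mul_le_iff₀ (by positivity), ← mul_pow]
  gcongr

/-- The shift of indices by the integer part of `2 ^ j • X`. -/
def shiftE (n : ℕ) (z w : ℕ → Fin n → ℤ) :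
    (ℕ × (Fin n → ℤ) × (Fin n → ℤ)) ≃ (ℕ × (Fin n → ℤ) × (Fin n → ℤ)) where
  toFun q := (q.1, q.2.1 + z q.1, q.2.2 + w q.1)
  invFun q := (q.1, q.2.1 - z q.1, q.2.2 - w q.1)
  left_inv q := by simp
  right_inv q := by simp

lemma floor_dist {n : ℕ} (y : En n) : ‖y - intVec n (fun i => ⌊y i⌋)‖ ≤ √n := by
  rw [EuclideanSpace.norm_eq]
  refine Real.sqrt_le_sqrt ?_
  calc ∑ i, ‖(y - intVec n (fun i => ⌊y i⌋)) i‖ ^ 2 ≤ ∑ i : Fin n, (1 : ℝ) := by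
        refine Finset.sum_le_sum fun i _ => ?_
        rw [PiLp.sub_apply, intVec_apply, Real.norm_eq_abs, sq_abs]
        have h1 := Int.floor_le (y i)
        have h2 := Int.lt_floor_add_one (y i)
        nlinarith
    _ = n := by simp

lemma intVec_add {n : ℕ} (k z : Fin n → ℤ) : intVec n (k + z) = intVec n k + intVec n z := by
  ext i
  simp [intVec_apply]

lemma shift_weight {n : ℕ} (y : En n) (k : Fin n → ℤ) (M : ℕ) :
    ((1 + ‖y - intVec n (k + fun i => ⌊y i⌋)‖) ^ M)⁻¹ ≤
      (1 + √n) ^ M * ((1 + ‖intVec n k‖) ^ M)⁻¹ := by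
  have h0 := floor_dist y
  have hs := Real.sqrt_nonneg (n : ℝ)
  refine inv_pow_aux (by simp) (by simp) (by simp) ?_ M
  rw [intVec_add]
  set z := intVec n (fun i => ⌊y i⌋)
  have : ‖intVec n k‖ ≤ ‖y - (intVec n k + z)‖ + ‖y - z‖ := by
    rw [← norm_neg (y - (intVec n k + z))]
    calc ‖intVec n k‖ = ‖-(y - (intVec n k + z)) + (y - z)‖ := by congr 1; abel
      _ ≤ _ := norm_add_le _ _
  nlinarith [norm_nonneg (y - (intVec n k + z))]

lemma local_weight {n : ℕ} (x : En n) (R : ℝ) (hR : ‖x‖ ≤ R) (j : ℕ) (k : Fin n → ℤ) (M : ℕ) :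
    ((1 + ‖(2 : ℝ) ^ j • x - intVec n k‖) ^ M)⁻¹ ≤
      ((2 : ℝ) ^ j * (1 + R)) ^ M * ((1 + ‖intVec n k‖) ^ M)⁻¹ := by
  have hR0 : 0 ≤ R := (norm_nonneg x).trans hR
  have h2 : (1 : ℝ) ≤ 2 ^ j := one_le_pow₀ (by norm_num)
  refine inv_pow_aux (by simp) (by simp) (by nlinarith) ?_ M
  have h3 : ‖(2 : ℝ) ^ j • x‖ ≤ 2 ^ j * R := by
    rw [norm_smul]
    simp only [norm_pow, Real.norm_ofNat]
    gcongr
  have : ‖intVec n k‖ ≤ ‖(2 : ℝ) ^ j • x - intVec n k‖ + ‖(2 : ℝ) ^ j • x‖ := by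
    rw [← norm_neg ((2 : ℝ) ^ j • x - intVec n k)]
    calc ‖intVec n k‖ = ‖-((2 : ℝ) ^ j • x - intVec n k) + (2 : ℝ) ^ j • x‖ := by congr 1; abel
      _ ≤ _ := norm_add_le _ _
  set d := ‖(2 : ℝ) ^ j • x - intVec n k‖
  have hd : 0 ≤ d := norm_nonneg _
  have h4 : 1 ≤ (2 : ℝ) ^ j * (1 + R) := by nlinarith
  nlinarith [mul_nonneg hd (sub_nonneg.2 h4)]

lemma master (n : ℕ) (m : ℝ) (Φ Ψ : SchwartzMap (En n) ℂ)
    (a : ℕ × (Fin n → ℤ) × (Fin n → ℤ) → ℂ)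
    (ha : ∀ N : ℝ, 0 < N → ∃ C : ℝ, ∀ (j : ℕ) (k l : Fin n → ℤ),
      ‖a (j, k, l)‖ ≤ C * (2 : ℝ) ^ (-(j : ℝ) * N) *
        (1 + (2 : ℝ) ^ (-(j : ℝ)) * ‖intVec n l‖) ^ m) (K P M : ℕ) : ∃ C : ℝ, 0 ≤ C ∧
    ∀ (q : ℕ × (Fin n → ℤ) × (Fin n → ℤ)) (X : En n × En n),
    ‖iteratedFDeriv ℝ K (wterm n Φ Ψ a q) X‖ ≤ C * (1 + ‖X.2‖) ^ m * ((2 : ℝ) ^ (q.1 * P))⁻¹ *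
      (((1 + ‖(2 : ℝ) ^ q.1 • X.1 - intVec n q.2.1‖) ^ M)⁻¹ *
      ((1 + ‖(2 : ℝ) ^ q.1 • X.2 - intVec n q.2.2‖) ^ M)⁻¹) := by
  obtain ⟨s, hs⟩ := exists_nat_ge |m|
  obtain ⟨C1, hC1, h1⟩ := wterm_bound n Φ Ψ a K (M + s)
  obtain ⟨C2, h2⟩ := ha ((P + (n + K) + 1 : ℕ) : ℝ) (by positivity)
  refine ⟨C1 * |C2|, by positivity, fun q X => (h1 q X).trans ?_⟩
  obtain ⟨j, k, l⟩ := q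
  obtain ⟨x, ξ⟩ := X
  have h3 := h2 j k l
  dsimp only
  set t : ℝ := (2 : ℝ) ^ j with ht
  have t1 : 1 ≤ t := one_le_pow₀ (by norm_num)
  have t0 : 0 < t := by linarith
  have e1 : (2 : ℝ) ^ (-(j : ℝ)) = t⁻¹ := by
    rw [Real.rpow_neg (by norm_num), Real.rpow_natCast]
  have e2 : (2 : ℝ) ^ (-(j : ℝ) * ((P + (n + K) + 1 : ℕ) : ℝ)) = (t ^ (P + (n + K) + 1))⁻¹ := by
    rw [Real.rpow_mul (by norm_num), e1, Real.rpow_natCast, inv_pow]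
  rw [e1, e2] at h3
  rw [pow_mul, pow_mul, ← ht]
  set D := 1 + ‖t • ξ - intVec n l‖ with hD
  set B := 1 + ‖ξ‖ with hB
  set u := 1 + ‖t • x - intVec n k‖ with hu
  have D1 : 1 ≤ D := by simp [hD]
  have B1 : 1 ≤ B := by simp [hB]
  have u1 : 1 ≤ u := by simp [hu]
  have D0 : 0 < D := by linarith
  have B0 : 0 < B := by linarith
  have u0 : 0 < u := by linarith
  have n1 : ‖t • ξ‖ = t * ‖ξ‖ := by rw [norm_smul, Real.norm_of_nonneg t0.le]
  have n2 : ‖intVec n l‖ ≤ ‖t • ξ - intVec n l‖ + t * ‖ξ‖ := by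
    rw [← n1, ← norm_neg (t • ξ - intVec n l)]
    calc ‖intVec n l‖ = ‖-(t • ξ - intVec n l) + t • ξ‖ := by congr 1; abel
      _ ≤ _ := norm_add_le _ _
  have n3 : t * ‖ξ‖ ≤ ‖t • ξ - intVec n l‖ + ‖intVec n l‖ := by
    rw [← n1]
    calc ‖t • ξ‖ = ‖(t • ξ - intVec n l) + intVec n l‖ := by congr 1; abel
      _ ≤ _ := norm_add_le _ _
  have hp : (1 + t⁻¹ * ‖intVec n l‖) ^ m ≤ B ^ m * D ^ s := by
    have d0 := norm_nonneg (t • ξ - intVec n l)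
    have x0 := norm_nonneg ξ
    have l0 := norm_nonneg (intVec n l)
    have i0 : 0 ≤ t⁻¹ * ‖intVec n l‖ := by positivity
    have i1 : t⁻¹ * ‖t • ξ - intVec n l‖ ≤ ‖t • ξ - intVec n l‖ :=
      mul_le_of_le_one_left d0 (inv_le_one_of_one_le₀ t1)
    have c1 : t⁻¹ * (t * ‖ξ‖) = ‖ξ‖ := inv_mul_cancel_left₀ t0.ne' _
    have m2 := mul_le_mul_of_nonneg_left n2 (inv_nonneg.2 t0.le)
    have m3 := mul_le_mul_of_nonneg_left n3 (inv_nonneg.2 t0.le)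
    rw [mul_add, c1] at m2
    rw [c1, mul_add] at m3
    refine peetre (by linarith) B1 D1 ?_ ?_ hs
    · rw [hB, hD]; nlinarith [mul_nonneg x0 d0]
    · rw [hB, hD]; nlinarith [mul_nonneg i0 d0]
  have hA : 0 ≤ (1 + t⁻¹ * ‖intVec n l‖) ^ m := by positivity
  have h4 : ‖a (j, k, l)‖ ≤ |C2| * (t ^ (P + (n + K)))⁻¹ * (B ^ m * D ^ s) := by
    refine h3.trans ?_
    have : (t ^ (P + (n + K) + 1))⁻¹ ≤ (t ^ (P + (n + K)))⁻¹ :=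
      inv_anti₀ (by positivity) (pow_le_pow_right₀ t1 (Nat.le_succ _))
    have := le_abs_self C2
    gcongr
  have h5 : (u ^ (M + s))⁻¹ ≤ (u ^ M)⁻¹ :=
    inv_anti₀ (by positivity) (pow_le_pow_right₀ u1 (Nat.le_add_right _ _))
  calc _ ≤ C1 * (|C2| * (t ^ (P + (n + K)))⁻¹ * (B ^ m * D ^ s) * t ^ (n + K)) *
        (u ^ M)⁻¹ * (D ^ (M + s))⁻¹ := by gcongr
    _ = _ := by
      rw [pow_add t, pow_add D]
      field_simp

lemma good_wterm (n : ℕ) (m : ℝ) (Φ Ψ : SchwartzMap (En n) ℂ)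
    (a : ℕ × (Fin n → ℤ) × (Fin n → ℤ) → ℂ)
    (ha : ∀ N : ℝ, 0 < N → ∃ C : ℝ, ∀ (j : ℕ) (k l : Fin n → ℤ),
      ‖a (j, k, l)‖ ≤ C * (2 : ℝ) ^ (-(j : ℝ) * N) *
        (1 + (2 : ℝ) ^ (-(j : ℝ)) * ‖intVec n l‖) ^ m) : GoodFam (wterm n Φ Ψ a) := by
  refine ⟨smooth_wterm n Φ Ψ a, fun K R => ?_⟩
  obtain ⟨C, hC, h⟩ := master n m Φ Ψ a ha K (2 * n + 2 * n + 1) (2 * n)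
  refine ⟨fun q => C * (1 + R) ^ |m| * ((1 + R) ^ (2 * n) * (1 + R) ^ (2 * n)) * gw n q,
    (summable_gw n).mul_left _, fun q X hX => (h q X).trans ?_⟩
  have hx : ‖X.1‖ ≤ R := (norm_fst_le X).trans hX.le
  have hξ : ‖X.2‖ ≤ R := (norm_snd_le X).trans hX.le
  have w1 := local_weight X.1 R hx q.1 q.2.1 (2 * n)
  have w2 := local_weight X.2 R hξ q.1 q.2.2 (2 * n)
  have hR0 : 0 ≤ R := (norm_nonneg _).trans hx
  have hm : (1 + ‖X.2‖) ^ m ≤ (1 + R) ^ |m| :=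
    (Real.rpow_le_rpow_of_exponent_le (by simp) (le_abs_self m)).trans
      (Real.rpow_le_rpow (by positivity) (by linarith) (abs_nonneg m))
  set t : ℝ := (2 : ℝ) ^ q.1 with ht
  have t0 : 0 < t := by positivity
  rw [pow_mul, ← ht]
  unfold gw
  dsimp only
  rw [← ht]
  calc _ ≤ C * (1 + R) ^ |m| * (t ^ (2 * n + 2 * n + 1))⁻¹ *
        ((t * (1 + R)) ^ (2 * n) * ((1 + ‖intVec n q.2.1‖) ^ (2 * n))⁻¹ *
        ((t * (1 + R)) ^ (2 * n) * ((1 + ‖intVec n q.2.2‖) ^ (2 * n))⁻¹)) := by gcongr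
    _ = _ := by
      rw [mul_pow, pow_add t, pow_add t]
      field_simp

lemma symbol_bound (n : ℕ) (m : ℝ) (Φ Ψ : SchwartzMap (En n) ℂ)
    (a : ℕ × (Fin n → ℤ) × (Fin n → ℤ) → ℂ)
    (ha : ∀ N : ℝ, 0 < N → ∃ C : ℝ, ∀ (j : ℕ) (k l : Fin n → ℤ),
      ‖a (j, k, l)‖ ≤ C * (2 : ℝ) ^ (-(j : ℝ) * N) *
        (1 + (2 : ℝ) ^ (-(j : ℝ)) * ‖intVec n l‖) ^ m) (K : ℕ) :
    ∃ C : ℝ, ∀ X : En n × En n, ∃ e : (ℕ × (Fin n → ℤ) × (Fin n → ℤ)) ≃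
      (ℕ × (Fin n → ℤ) × (Fin n → ℤ)), ∀ q,
      ‖iteratedFDeriv ℝ K (wterm n Φ Ψ a (e q)) X‖ ≤ C * (1 + ‖X.2‖) ^ m * gw n q := by
  obtain ⟨C, hC, h⟩ := master n m Φ Ψ a ha K 1 (2 * n)
  refine ⟨C * ((1 + √n) ^ (2 * n) * (1 + √n) ^ (2 * n)), fun X =>
    ⟨shiftE n (fun j i => ⌊((2 : ℝ) ^ j • X.1) i⌋) (fun j i => ⌊((2 : ℝ) ^ j • X.2) i⌋),
      fun q => (h _ X).trans ?_⟩⟩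
  have w1 := shift_weight ((2 : ℝ) ^ q.1 • X.1) q.2.1 (2 * n)
  have w2 := shift_weight ((2 : ℝ) ^ q.1 • X.2) q.2.2 (2 * n)
  simp only [shiftE, Equiv.coe_fn_mk, mul_one]
  unfold gw
  calc _ ≤ C * (1 + ‖X.2‖) ^ m * ((2 : ℝ) ^ q.1)⁻¹ *
        ((1 + √n) ^ (2 * n) * ((1 + ‖intVec n q.2.1‖) ^ (2 * n))⁻¹ *
        ((1 + √n) ^ (2 * n) * ((1 + ‖intVec n q.2.2‖) ^ (2 * n))⁻¹)) := by gcongr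
    _ = _ := by ring

/-- If the coefficients satisfy `|a_{j,k,l}| ≤ C_N 2^{−jN} (1+2^{−j}|l|)^m` for every `N > 0`,
then the series `σ(x,ξ) = ∑ a_{j,k,l} 2^{jn} Φ(2^j x−k) Ψ(2^j ξ−l)` converges absolutely,
together with all its termwise derivatives, to a smooth symbol `σ ∈ S^m_{0,0}`. -/
theorem stmt_14 (n : ℕ) (hn : 1 ≤ n) (m : ℝ) (Φ Ψ : SchwartzMap (En n) ℂ)
    (a : ℕ × (Fin n → ℤ) × (Fin n → ℤ) → ℂ)
    (ha : ∀ N : ℝ, 0 < N → ∃ C : ℝ, ∀ (j : ℕ) (k l : Fin n → ℤ),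
      ‖a (j, k, l)‖ ≤ C * (2 : ℝ) ^ (-(j : ℝ) * N) *
        (1 + (2 : ℝ) ^ (-(j : ℝ)) * ‖intVec n l‖) ^ m) :
    ∃ σ : En n × En n → ℂ,
      (∀ (α β : Fin n → ℕ) (X : En n × En n),
        Summable fun q : ℕ × (Fin n → ℤ) × (Fin n → ℤ) =>
          ‖mixD n α β (wterm n Φ Ψ a q) X‖) ∧
      (∀ (α β : Fin n → ℕ) (X : En n × En n),
        HasSum (fun q : ℕ × (Fin n → ℤ) × (Fin n → ℤ) =>
          mixD n α β (wterm n Φ Ψ a q) X) (mixD n α β σ X)) ∧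
      IsHormander n m 0 0 σ := by

  have hG := good_wterm n m Φ Ψ a ha
  refine ⟨fun X => ∑' q, wterm n Φ Ψ a q X, fun α β X => ?_, fun α β X => ?_, hG.contDiff,
    fun α β => ?_⟩
  · exact (hG.pdSeq _).1.summable X
  · have h := hG.pdSeq (dirList α (fun i => (unitE n i, (0 : En n))) ++
      dirList β (fun i => ((0 : En n), unitE n i)))
    unfold mixD
    rw [h.2]
    exact (h.1.summable X).of_norm.hasSum
  · set L := dirList α (fun i => (unitE n i, (0 : En n))) ++
      dirList β (fun i => ((0 : En n), unitE n i)) with hL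
    have h := hG.pdSeq L
    obtain ⟨D, hD, hb⟩ := bound_pdSeq L
    obtain ⟨C, hC⟩ := symbol_bound n m Φ Ψ a ha (0 + L.length)
    refine ⟨D * C * ∑' q, gw n q, fun x ξ => ?_⟩
    obtain ⟨e, he⟩ := hC (x, ξ)
    have hs := h.1.summable (x, ξ)
    have hse : Summable fun q => ‖pdSeq L (wterm n Φ Ψ a (e q)) (x, ξ)‖ :=
      hs.comp_injective e.injective
    simp only [zero_mul, sub_zero, add_zero]
    unfold mixD
    rw [← hL, h.2]
    clear_value L
    calc ‖∑' q, pdSeq L (wterm n Φ Ψ a q) (x, ξ)‖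
        ≤ ∑' q, ‖pdSeq L (wterm n Φ Ψ a q) (x, ξ)‖ := norm_tsum_le_tsum_norm hs
      _ = ∑' q, ‖pdSeq L (wterm n Φ Ψ a (e q)) (x, ξ)‖ :=
          (e.tsum_eq fun q => ‖pdSeq L (wterm n Φ Ψ a q) (x, ξ)‖).symm
      _ ≤ ∑' q, D * (C * (1 + ‖ξ‖) ^ m) * gw n q := by
          refine Summable.tsum_le_tsum (fun q => ?_) hse
            ((summable_gw n).mul_left _)
          have h1 := hb _ (smooth_wterm n Φ Ψ a (e q)) 0 (x, ξ)
          rw [norm_iteratedFDeriv_zero] at h1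
          refine h1.trans ?_
          rw [mul_assoc]
          exact mul_le_mul_of_nonneg_left (he q) hD
      _ = _ := by rw [tsum_mul_left]; ring
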